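/- Fundamental inequality for the pre-relaxed block Jacobi step: for any p, q ∈ C, if for each k the element t_k ∈ C_k minimizes p_k ↦ F_k(N_c p_k − (N_c − 1) R_k q; q) over C_k, and P(q) = Σ_{k=1}^{N_c} R_k* t_k, then (1/N_c) F(p) − (1/N_c) F(P(q)) ≥ D(p, P(q)) − D(p, q). -/

import Mathlib

open Finset

noncomputable section

/-- The discrete image domain of `M × N` pixels. -/
abbrev Idx (M N : ℕ) := Fin M × Fin N

/-- The discrete divergence operator `div : W → V`, the negative adjoint of
the discrete gradient. -/
def divOp {M N : ℕ} (p : Idx M N → ℝ × ℝ) : Idx M N → ℝ := fun x =>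
  ((if (x.1 : ℕ) + 1 < M then (p x).1 else 0)
    - (if 1 ≤ (x.1 : ℕ) then
        (p (⟨(x.1 : ℕ) - 1, lt_of_le_of_lt (Nat.sub_le _ _) x.1.isLt⟩, x.2)).1 else 0))
  + ((if (x.2 : ℕ) + 1 < N then (p x).2 else 0)
    - (if 1 ≤ (x.2 : ℕ) then
        (p (x.1, ⟨(x.2 : ℕ) - 1, lt_of_le_of_lt (Nat.sub_le _ _) x.2.isLt⟩)).2 else 0))

/-- The discrete gradient operator `∇ : V → W`. -/
def gradOp {M N : ℕ} (u : Idx M N → ℝ) : Idx M N → ℝ × ℝ := fun x =>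
  ((if h : (x.1 : ℕ) + 1 < M then u (⟨(x.1 : ℕ) + 1, h⟩, x.2) - u x else 0),
   (if h : (x.2 : ℕ) + 1 < N then u (x.1, ⟨(x.2 : ℕ) + 1, h⟩) - u x else 0))

/-- Euclidean inner product on `V`. -/
def innerV {M N : ℕ} (u v : Idx M N → ℝ) : ℝ := ∑ x, u x * v x

/-- Euclidean inner product on `W`. -/
def innerW {M N : ℕ} (p q : Idx M N → ℝ × ℝ) : ℝ :=
  ∑ x, ((p x).1 * (q x).1 + (p x).2 * (q x).2)

/-- Squared Euclidean norm on `V`. -/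
def normVsq {M N : ℕ} (u : Idx M N → ℝ) : ℝ := ∑ x, (u x) ^ 2

/-- Max (Euclidean-pointwise) norm on `W`. -/
def normWinf {M N : ℕ} (p : Idx M N → ℝ × ℝ) : ℝ :=
  ⨆ x : Idx M N, Real.sqrt ((p x).1 ^ 2 + (p x).2 ^ 2)

/-- The dual ROF energy `F(p) = (1/2)‖div p + α f‖₂²`. -/
def F {M N : ℕ} (α : ℝ) (f : Idx M N → ℝ) (p : Idx M N → ℝ × ℝ) : ℝ :=
  (1 / 2) * normVsq (fun x => divOp p x + α * f x)

/-- The gradient of `F`, namely `∇F(q) = div*(div q + α f) = -∇(div q + α f)`. -/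
def gradF {M N : ℕ} (α : ℝ) (f : Idx M N → ℝ) (q : Idx M N → ℝ × ℝ) :
    Idx M N → ℝ × ℝ :=
  fun x => - gradOp (fun y => divOp q y + α * f y) x

/-- The constraint set `C = {p ∈ W : |p_{ij}| ≤ 1 ∀ (i,j)}`. -/
def Cset (M N : ℕ) : Set (Idx M N → ℝ × ℝ) :=
  {p | ∀ x, Real.sqrt ((p x).1 ^ 2 + (p x).2 ^ 2) ≤ 1}

/-- Restriction operator `R_k : W → W_k`. -/
def Rk {M N : ℕ} (S : Finset (Idx M N)) (p : Idx M N → ℝ × ℝ) :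
    {x // x ∈ S} → ℝ × ℝ :=
  fun x => p x.1

/-- Extension-by-zero operator `R_k* : W_k → W`. -/
def Ek {M N : ℕ} (S : Finset (Idx M N)) (pk : {x // x ∈ S} → ℝ × ℝ) :
    Idx M N → ℝ × ℝ :=
  fun x => if h : x ∈ S then pk ⟨x, h⟩ else 0

/-- The orthogonal projection `R_k* R_k : W → W`. -/
def projk {M N : ℕ} (S : Finset (Idx M N)) (p : Idx M N → ℝ × ℝ) :
    Idx M N → ℝ × ℝ :=
  fun x => if x ∈ S then p x else 0

/-- The local constraint set `C_k = R_k C`. -/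
def Ck {M N : ℕ} (S : Finset (Idx M N)) : Set ({x // x ∈ S} → ℝ × ℝ) :=
  Rk S '' Cset M N

/-- The local energy `F_k(p_k; r) = F(R_k* p_k + (I - R_k* R_k) r)`. -/
def Fk {M N : ℕ} (α : ℝ) (f : Idx M N → ℝ) (S : Finset (Idx M N))
    (pk : {x // x ∈ S} → ℝ × ℝ) (r : Idx M N → ℝ × ℝ) : ℝ :=
  F α f (Ek S pk + (r - projk S r))

/-- Euclidean inner product on `W_k`. -/
def innerWk {M N : ℕ} (S : Finset (Idx M N)) (pk qk : {x // x ∈ S} → ℝ × ℝ) : ℝ :=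
  ∑ x : {x // x ∈ S}, ((pk x).1 * (qk x).1 + (pk x).2 * (qk x).2)

/-- The distance-like quantity `D(p,q) = Σ_k (1/2)‖div R_k* R_k (p - q)‖₂²`. -/
def Ddist {M N Nc : ℕ} (S : Fin Nc → Finset (Idx M N))
    (p q : Idx M N → ℝ × ℝ) : ℝ :=
  ∑ k, (1 / 2) * normVsq (divOp (projk (S k) (p - q)))

/-- The rectangular subdomain `Ω_s` of size `m × n` indexed by `s : Fin Ms × Fin Ns`
(for an `M × N` image with `M = Ms * m`, `N = Ns * n`). -/
def block {M N Ms Ns : ℕ} (m n : ℕ) (s : Fin Ms × Fin Ns) : Finset (Idx M N) :=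
  Finset.univ.filter fun x => (x.1 : ℕ) / m = (s.1 : ℕ) ∧ (x.2 : ℕ) / n = (s.2 : ℕ)

end

/-- The discrete divergence as a linear map. -/
def divLinear (M N : ℕ) : (Idx M N → ℝ × ℝ) →ₗ[ℝ] (Idx M N → ℝ) where
  toFun := divOp
  map_add' p q := by
    funext x
    simp only [divOp, Pi.add_apply, Prod.fst_add, Prod.snd_add]
    split_ifs <;> ring
  map_smul' c p := by
    funext x
    simp only [divOp, Pi.smul_apply, Prod.smul_fst, Prod.smul_snd, smul_eq_mul, RingHom.id_apply]
    split_ifs <;> ring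

theorem divLinear_apply {M N : ℕ} (p : Idx M N → ℝ × ℝ) : divLinear M N p = divOp p := rfl

theorem mem_Cset_iff {M N : ℕ} (p : Idx M N → ℝ × ℝ) :
    p ∈ Cset M N ↔ ∀ x, (p x).1 ^ 2 + (p x).2 ^ 2 ≤ 1 := by
  simp only [Cset, Set.mem_ofPred_eq, Real.sqrt_le_one]

theorem convex_Cset (M N : ℕ) : Convex ℝ (Cset M N) := by
  intro p hp q hq a b ha hb hab
  rw [mem_Cset_iff] at *
  intro x
  simp only [Pi.add_apply, Pi.smul_apply, Prod.fst_add, Prod.snd_add, Prod.smul_fst,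
    Prod.smul_snd, smul_eq_mul]
  obtain rfl : b = 1 - a := by linarith
  nlinarith [mul_le_mul_of_nonneg_left (hp x) ha, mul_le_mul_of_nonneg_left (hq x) hb,
    mul_nonneg (mul_nonneg ha hb) (add_nonneg (sq_nonneg ((p x).1 - (q x).1))
      (sq_nonneg ((p x).2 - (q x).2)))]

theorem normVsq_add {M N : ℕ} (u v : Idx M N → ℝ) :
    normVsq (u + v) = normVsq u + 2 * innerV u v + normVsq v := by
  simp only [normVsq, innerV, mul_sum, ← sum_add_distrib, Pi.add_apply]
  exact sum_congr rfl fun x _ => by ring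

theorem normVsq_smul {M N : ℕ} (c : ℝ) (u : Idx M N → ℝ) :
    normVsq (c • u) = c ^ 2 * normVsq u := by
  simp only [normVsq, mul_sum, Pi.smul_apply, smul_eq_mul, mul_pow]

theorem normVsq_nonneg {M N : ℕ} (u : Idx M N → ℝ) : 0 ≤ normVsq u :=
  sum_nonneg fun _ _ => sq_nonneg _

theorem innerV_smul_right {M N : ℕ} (c : ℝ) (u v : Idx M N → ℝ) :
    innerV u (c • v) = c * innerV u v := by
  simp only [innerV, mul_sum, Pi.smul_apply, smul_eq_mul]
  exact sum_congr rfl fun x _ => by ring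

theorem innerV_nonneg_of_normVsq_le {M N : ℕ} (w g : Idx M N → ℝ)
    (h : ∀ θ : ℝ, 0 ≤ θ → θ ≤ 1 → normVsq w ≤ normVsq (w + θ • g)) : 0 ≤ innerV w g := by
  by_contra! hneg
  have hg := normVsq_nonneg g
  set a := innerV w g with ha
  set b := normVsq g with hb
  have hpos : 0 < b - a := by linarith
  have h1 := h (-a / (b - a)) (div_nonneg (by linarith) hpos.le)
    ((div_le_one hpos).2 (by linarith))
  rw [normVsq_add, innerV_smul_right, normVsq_smul, ← ha, ← hb] at h1
  set θ := -a / (b - a) with hθ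
  have hθpos : 0 < θ := div_pos (by linarith) hpos
  have hmul : θ * (b - a) = -a := div_mul_cancel₀ _ hpos.ne'
  have h2 : 0 ≤ θ * (2 * a + θ * b) := by linarith [sq θ, mul_assoc θ θ b]
  have h3 := nonneg_of_mul_nonneg_right h2 hθpos
  nlinarith

theorem normVsq_sum_le {M N Nc : ℕ} (a : Fin Nc → Idx M N → ℝ) :
    normVsq (∑ k, a k) ≤ Nc * ∑ k, normVsq (a k) := by
  simp only [normVsq, Finset.sum_apply]
  rw [sum_comm, mul_sum]
  refine sum_le_sum fun x _ => ?_
  simpa using sq_sum_le_card_mul_sum_sq (s := univ) (f := fun k => a k x)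

theorem F_add {M N : ℕ} (α : ℝ) (f : Idx M N → ℝ) (q d : Idx M N → ℝ × ℝ) :
    F α f (q + d) = (1 / 2) * normVsq ((fun x => divOp q x + α * f x) + divLinear M N d) := by
  have h := map_add (divLinear M N) q d
  rw [divLinear_apply, divLinear_apply q] at h
  simp only [F, h]
  congr 2
  funext x
  simp only [Pi.add_apply]
  ring

theorem Fk_prerelaxed {M N : ℕ} (α : ℝ) (f : Idx M N → ℝ) (S : Finset (Idx M N)) (c : ℝ)
    (r : {x // x ∈ S} → ℝ × ℝ) (q : Idx M N → ℝ × ℝ) :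
    Fk α f S (c • r - (c - 1) • Rk S q) q = F α f (q + c • (Ek S r - projk S q)) := by
  unfold Fk
  congr 1
  funext x
  by_cases hx : x ∈ S
  · simp only [Ek, projk, Rk, hx, Pi.add_apply, Pi.sub_apply, Pi.smul_apply, dite_true, if_true]
    module
  · simp [Ek, projk, hx]

theorem Ek_Rk {M N : ℕ} (S : Finset (Idx M N)) (p : Idx M N → ℝ × ℝ) :
    Ek S (Rk S p) = projk S p := by
  funext x
  simp [Ek, Rk, projk]

/-- The orthogonal projection `projk S` as a linear map. -/
def projLinear {M N : ℕ} (S : Finset (Idx M N)) :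
    (Idx M N → ℝ × ℝ) →ₗ[ℝ] (Idx M N → ℝ × ℝ) where
  toFun := projk S
  map_add' p q := by
    funext x
    by_cases hx : x ∈ S <;> simp [projk, hx]
  map_smul' c p := by
    funext x
    by_cases hx : x ∈ S <;> simp [projk, hx]

theorem projLinear_apply {M N : ℕ} (S : Finset (Idx M N)) (p : Idx M N → ℝ × ℝ) :
    projLinear S p = projk S p := rfl

theorem sum_projk {M N Nc : ℕ} (S : Fin Nc → Finset (Idx M N))
    (hdisj : ∀ k l, k ≠ l → Disjoint (S k) (S l)) (hcover : ∀ x : Idx M N, ∃ k, x ∈ S k)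
    (p : Idx M N → ℝ × ℝ) : ∑ k, projk (S k) p = p := by
  funext x
  obtain ⟨k, hk⟩ := hcover x
  rw [Finset.sum_apply, sum_eq_single k]
  · simp [projk, hk]
  · intro l _ hl
    simp [projk, disjoint_right.1 (hdisj l k hl) hk]
  · simp

theorem projk_sum_Ek {M N Nc : ℕ} (S : Fin Nc → Finset (Idx M N))
    (hdisj : ∀ k l, k ≠ l → Disjoint (S k) (S l))
    (t : ∀ k : Fin Nc, {x // x ∈ S k} → ℝ × ℝ) (k : Fin Nc) :
    projk (S k) (∑ l, Ek (S l) (t l)) = Ek (S k) (t k) := by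
  funext x
  by_cases hk : x ∈ S k
  · simp only [projk, hk, if_true]
    rw [Finset.sum_apply, sum_eq_single k]
    · intro l _ hl
      simp [Ek, disjoint_right.1 (hdisj l k hl) hk]
    · simp
  · simp [projk, Ek, hk]

/-- First-order optimality condition of the pre-relaxed local problem on one subdomain. -/
theorem prerelaxed_local_optimality {M N : ℕ} (α : ℝ) (f : Idx M N → ℝ)
    (S : Finset (Idx M N)) (c : ℝ) (hc : 0 < c) (p q : Idx M N → ℝ × ℝ) (hp : p ∈ Cset M N)
    (t : {x // x ∈ S} → ℝ × ℝ) (ht : t ∈ Ck S)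
    (hmin : ∀ r ∈ Ck S, Fk α f S (c • t - (c - 1) • Rk S q) q
      ≤ Fk α f S (c • r - (c - 1) • Rk S q) q) :
    0 ≤ innerV ((fun x => divOp q x + α * f x) + c • divLinear M N (Ek S t - projk S q))
      (divLinear M N (projk S (p - q)) - divLinear M N (Ek S t - projk S q)) := by
  obtain ⟨s, hs, rfl⟩ := ht
  rw [Ek_Rk]
  refine nonneg_of_mul_nonneg_right (a := c) ?_ hc
  rw [← innerV_smul_right]
  refine innerV_nonneg_of_normVsq_le _ _ fun θ h0 h1 => ?_
  have h := hmin _ ⟨_, convex_Cset M N hs hp (sub_nonneg.2 h1) h0 (sub_add_cancel 1 θ), rfl⟩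
  rw [Fk_prerelaxed, Fk_prerelaxed, F_add, F_add, Ek_Rk, Ek_Rk] at h
  simp only [← projLinear_apply, map_smul, map_add, map_sub] at h ⊢
  refine (le_of_mul_le_mul_left h one_half_pos).trans_eq ?_
  congr 1
  module

theorem prerelaxed_jacobi_fundamental (M N : ℕ) (α : ℝ) (hα : 0 < α) (f : Idx M N → ℝ)
    (Nc : ℕ) (S : Fin Nc → Finset (Idx M N))
    (hdisj : ∀ k l, k ≠ l → Disjoint (S k) (S l))
    (hcover : ∀ x : Idx M N, ∃ k, x ∈ S k)
    (p q : Idx M N → ℝ × ℝ) (hp : p ∈ Cset M N) (hq : q ∈ Cset M N)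
    (t : ∀ k : Fin Nc, {x // x ∈ S k} → ℝ × ℝ)
    (ht : ∀ k, t k ∈ Ck (S k))
    (hmin : ∀ k, ∀ rk ∈ Ck (S k),
      Fk α f (S k) ((Nc : ℝ) • t k - ((Nc : ℝ) - 1) • Rk (S k) q) q
        ≤ Fk α f (S k) ((Nc : ℝ) • rk - ((Nc : ℝ) - 1) • Rk (S k) q) q) :
    (1 / (Nc : ℝ)) * F α f p - (1 / (Nc : ℝ)) * F α f (∑ k, Ek (S k) (t k))
      ≥ Ddist S p (∑ k, Ek (S k) (t k)) - Ddist S p q := by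
  obtain rfl | hNc := Nat.eq_zero_or_pos Nc
  · simp [Ddist]
  have hc : (0 : ℝ) < Nc := Nat.cast_pos.2 hNc
  set P := ∑ k, Ek (S k) (t k) with hP
  set v : Idx M N → ℝ := fun x => divOp q x + α * f x with hv
  set a : Fin Nc → Idx M N → ℝ := fun k => divLinear M N (Ek (S k) (t k) - projk (S k) q) with ha
  set b : Fin Nc → Idx M N → ℝ := fun k => divLinear M N (projk (S k) (p - q)) with hb
  have hopt : ∀ k, 0 ≤ innerV (v + (Nc : ℝ) • a k) (b k - a k) := fun k =>
    prerelaxed_local_optimality α f (S k) Nc hc p q hp (t k) (ht k) (hmin k)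
  have hsumb : divLinear M N (p - q) = ∑ k, b k := by
    rw [hb, ← map_sum, sum_projk S hdisj hcover]
  have hsuma : divLinear M N (P - q) = ∑ k, a k := by
    rw [ha, ← map_sum, sum_sub_distrib, sum_projk S hdisj hcover]
  have hFp : F α f p = (1 / 2) * normVsq (v + ∑ k, b k) := by
    rw [← hsumb, ← F_add, add_sub_cancel]
  have hFP : F α f P = (1 / 2) * normVsq (v + ∑ k, a k) := by
    rw [← hsuma, ← F_add, add_sub_cancel]
  have hDq : Ddist S p q = ∑ k, (1 / 2) * normVsq (b k) := rfl
  have hDP : Ddist S p P = ∑ k, (1 / 2) * normVsq (b k - a k) := by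
    refine sum_congr rfl fun k _ => ?_
    rw [← divLinear_apply, ha, hb]
    simp only [← map_sub]
    congr 3
    rw [← projk_sum_Ek S hdisj t k, ← hP]
    simp only [← projLinear_apply, map_sub]
    abel
  have hterm : ∀ k, innerV (v + (Nc : ℝ) • a k) (b k - a k)
      = innerV v (b k) - innerV v (a k)
        + Nc * ((1 / 2) * normVsq (b k) - (1 / 2) * normVsq (b k - a k)
          - (1 / 2) * normVsq (a k)) := by
    intro k
    simp only [innerV, normVsq, mul_sum, ← sum_add_distrib, ← sum_sub_distrib, Pi.add_apply,
      Pi.sub_apply, Pi.smul_apply, smul_eq_mul]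
    exact sum_congr rfl fun x _ => by ring
  have hinner : ∀ g : Fin Nc → Idx M N → ℝ, innerV v (∑ k, g k) = ∑ k, innerV v (g k) := by
    intro g
    simp only [innerV, Finset.sum_apply, mul_sum]
    exact sum_comm
  have hsum := sum_nonneg fun k (_ : k ∈ univ) => hopt k
  simp only [hterm, sum_add_distrib, sum_sub_distrib, ← mul_sum] at hsum
  have hCS := normVsq_sum_le a
  have hB := normVsq_nonneg (∑ k, b k)
  rw [hFp, hFP, hDq, hDP, normVsq_add, normVsq_add, hinner, hinner]
  simp only [← mul_sum]
  rw [ge_iff_le, ← mul_sub (1 / (Nc : ℝ)), one_div_mul_eq_div (Nc : ℝ), le_div_iff₀ hc]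
  linarith
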